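/- Let T be an essentially small, Krull–Schmidt, k-linear, Hom-finite triangulated category over a commutative ring k, let s be a basic silting object, S = add(s), and let u ∈ S * ΣS be a presilting object. Then there exists an object u' ∈ S * ΣS such that u ⊕ u' is a silting object (Bongartz completion). In particular, one may take u' as the cone of a map s → u', constructed from a right add(u)-approximation u₀ → Σs via the triangle s → u' → u₀ → Σs. -/

import Mathlib

open CategoryTheory Category Limits Pretriangulated

variable {C : Type*} [Category C] [Preadditive C] [HasZeroObject C] [HasShift C ℤ]
  [∀ n : ℤ, (shiftFunctor C n).Additive] [Pretriangulated C] [HasFiniteBiproducts C]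

/-- `add(s)`: direct summands of finite direct sums of copies of `s`. -/
def addSet (s : C) : Set C :=
  {x | ∃ (n : ℕ) (i : x ⟶ ⨁ (fun _ : Fin n => s)) (r : (⨁ fun _ : Fin n => s) ⟶ x),
    i ≫ r = 𝟙 x}

/-- `S * ΣS` for `S = add(s)`: objects `t` admitting a distinguished triangle
`s₁ → s₀ → t → Σs₁` with `s₀, s₁ ∈ add(s)`. -/
def twoTermOf (s : C) : Set C :=
  {t | ∃ (s₁ s₀ : C) (_ : s₁ ∈ addSet s) (_ : s₀ ∈ addSet s) (f : s₁ ⟶ s₀)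
    (g : s₀ ⟶ t) (h : t ⟶ s₁⟦(1 : ℤ)⟧), Triangle.mk f g h ∈ distTriang C}

/-- A class closed under isomorphisms, shifts, extensions and direct summands. -/
def IsThickSet (P : Set C) : Prop :=
  (∀ x y : C, Nonempty (x ≅ y) → x ∈ P → y ∈ P) ∧
  (∀ x ∈ P, x⟦(1 : ℤ)⟧ ∈ P) ∧
  (∀ x ∈ P, x⟦(-1 : ℤ)⟧ ∈ P) ∧
  (∀ (x y z : C) (f : x ⟶ y) (g : y ⟶ z) (w : z ⟶ x⟦(1 : ℤ)⟧),
    Triangle.mk f g w ∈ (distTriang C) → x ∈ P → z ∈ P → y ∈ P) ∧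
  (∀ x y : C, (∃ (i : x ⟶ y) (r : y ⟶ x), i ≫ r = 𝟙 x) → y ∈ P → x ∈ P)

/-- `u` is a presilting object: `Hom(u, Σⁱu) = 0` for all `i ≥ 1`. -/
def PresiltingObj (u : C) : Prop := ∀ i : ℤ, 1 ≤ i → ∀ f : u ⟶ u⟦i⟧, f = 0

/-- `u` is a silting object: presilting and `thick(u) = C`. -/
def SiltingObj (u : C) : Prop :=
  PresiltingObj u ∧ ∀ P : Set C, IsThickSet P → u ∈ P → ∀ x : C, x ∈ P

/-- A decomposition of `x` into `n` pairwise non-isomorphic indecomposable (local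
endomorphism ring) direct summands; witnesses that `x` is basic with `#(x) = n`. -/
def BasicDecomp (x : C) (n : ℕ) (f : Fin n → C) : Prop :=
  (∀ i, IsLocalRing (End (f i))) ∧
  (∀ i j, Nonempty (f i ≅ f j) → i = j) ∧
  Nonempty (x ≅ ⨁ f)

/-- Krull–Schmidt: every object is a finite direct sum of objects with local
endomorphism rings. -/
def KrullSchmidt (C : Type*) [Category C] [Preadditive C] [HasFiniteBiproducts C] : Prop :=
  ∀ x : C, ∃ (n : ℕ) (f : Fin n → C),
    (∀ i, IsLocalRing (End (f i))) ∧ Nonempty (x ≅ ⨁ f)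

set_option linter.unusedSectionVars false

/-- `Hom(x, Σⁱy) = 0`. -/
def HomVanish (x y : C) (i : ℤ) : Prop := ∀ f : x ⟶ y⟦i⟧, f = 0

namespace HomVanish

lemma shift_left_iff (x y : C) {a i j : ℤ} (h : j + a = i) :
    HomVanish (x⟦a⟧) y i ↔ HomVanish x y j := by
  let e : (y⟦j⟧)⟦a⟧ ≅ y⟦i⟧ := ((shiftFunctorAdd' C j a i h).app y).symm
  constructor
  · intro H f
    apply (shiftFunctor C a).map_injective
    rw [Functor.map_zero, ← cancel_mono e.hom, zero_comp]
    exact H _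
  · intro H f
    obtain ⟨g, hg⟩ := (shiftFunctor C a).map_surjective (f ≫ e.inv)
    rw [H g, Functor.map_zero] at hg
    rw [← cancel_mono e.inv, ← hg, zero_comp]

lemma shift_right_iff (x y : C) {a i j : ℤ} (h : a + i = j) :
    HomVanish x (y⟦a⟧) i ↔ HomVanish x y j := by
  let e : (y⟦a⟧)⟦i⟧ ≅ y⟦j⟧ := ((shiftFunctorAdd' C a i j h).app y).symm
  constructor
  · intro H f
    rw [← cancel_mono e.inv, zero_comp]
    exact H _
  · intro H f
    rw [← cancel_mono e.hom, zero_comp]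
    exact H _

lemma iff_forall_hom (x y : C) (i : ℤ) :
    HomVanish x y i ↔ ∀ f : x⟦-i⟧ ⟶ y, f = 0 := by
  rw [← shift_left_iff x y (a := -i) (i := 0) (by simp)]
  let e : y⟦(0 : ℤ)⟧ ≅ y := (shiftFunctorZero C ℤ).app y
  constructor
  · intro H f
    rw [← cancel_mono e.inv, zero_comp]
    exact H _
  · intro H f
    rw [← cancel_mono e.hom, zero_comp]
    exact H _

lemma of_retract_left {x x' y : C} {i : ℤ} (H : HomVanish x y i) (a : x' ⟶ x) (r : x ⟶ x')
    (h : a ≫ r = 𝟙 x') : HomVanish x' y i := fun f => by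
  rw [← id_comp f, ← h, assoc, H (r ≫ f), comp_zero]

lemma of_retract_right {x y y' : C} {i : ℤ} (H : HomVanish x y i) (a : y' ⟶ y) (r : y ⟶ y')
    (h : a ≫ r = 𝟙 y') : HomVanish x y' i := fun f => by
  have e : f ≫ a⟦i⟧' ≫ r⟦i⟧' = f := by
    rw [← Functor.map_comp, h, CategoryTheory.Functor.map_id, comp_id]
  rw [← e, ← assoc, H (f ≫ _), zero_comp]

lemma biproduct_left {x y : C} {i : ℤ} (H : HomVanish x y i) (n : ℕ) :
    HomVanish (⨁ fun _ : Fin n => x) y i := fun f => by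
  ext j
  rw [H (_ ≫ f), comp_zero]

lemma biproduct_right {x y : C} {i : ℤ} (H : HomVanish x y i) (n : ℕ) :
    HomVanish x (⨁ fun _ : Fin n => y) i := by
  rw [iff_forall_hom] at H ⊢
  intro f
  ext j
  rw [H (f ≫ _), zero_comp]

lemma covariant₂ {T : Triangle C} (hT : T ∈ distTriang C) {a : C} {i : ℤ}
    (h₁ : HomVanish a T.obj₁ i) (h₃ : HomVanish a T.obj₃ i) : HomVanish a T.obj₂ i := by
  rw [iff_forall_hom] at h₁ h₃ ⊢
  intro f
  obtain ⟨g, rfl⟩ := Triangle.coyoneda_exact₂ T hT f (h₃ _)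
  rw [h₁ g, zero_comp]

lemma covariant₃ {T : Triangle C} (hT : T ∈ distTriang C) {a : C} {i j : ℤ} (hij : 1 + i = j)
    (h₂ : HomVanish a T.obj₂ i) (h₁ : HomVanish a T.obj₁ j) : HomVanish a T.obj₃ i :=
  covariant₂ (rot_of_distTriang T hT) h₂ ((shift_right_iff _ _ hij).2 h₁)

lemma covariant₁ {T : Triangle C} (hT : T ∈ distTriang C) {a : C} {i j : ℤ} (hij : -1 + i = j)
    (h₂ : HomVanish a T.obj₂ i) (h₃ : HomVanish a T.obj₃ j) : HomVanish a T.obj₁ i :=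
  covariant₂ (inv_rot_of_distTriang T hT) ((shift_right_iff _ _ hij).2 h₃) h₂

lemma contravariant₂ {T : Triangle C} (hT : T ∈ distTriang C) {b : C} {i : ℤ}
    (h₁ : HomVanish T.obj₁ b i) (h₃ : HomVanish T.obj₃ b i) : HomVanish T.obj₂ b i := by
  intro f
  obtain ⟨g, rfl⟩ := Triangle.yoneda_exact₂ T hT f (h₁ _)
  rw [h₃ g, comp_zero]

lemma contravariant₃ {T : Triangle C} (hT : T ∈ distTriang C) {b : C} {i j : ℤ} (hij : j + 1 = i)
    (h₂ : HomVanish T.obj₂ b i) (h₁ : HomVanish T.obj₁ b j) : HomVanish T.obj₃ b i :=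
  contravariant₂ (rot_of_distTriang T hT) h₂ ((shift_left_iff _ _ hij).2 h₁)

lemma contravariant₁ {T : Triangle C} (hT : T ∈ distTriang C) {b : C} {i j : ℤ}
    (hij : j + -1 = i) (h₂ : HomVanish T.obj₂ b i) (h₃ : HomVanish T.obj₃ b j) :
    HomVanish T.obj₁ b i :=
  contravariant₂ (inv_rot_of_distTriang T hT) ((shift_left_iff _ _ hij).2 h₃) h₂

/-- The cocone of a right `b`-approximation has no extensions by `b`, provided that the
approximating object has none. -/
lemma cocone_of_approximation {T : Triangle C} (hT : T ∈ distTriang C) {b : C}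
    (happ : ∀ f : b ⟶ T.obj₃, ∃ g : b ⟶ T.obj₂, g ≫ T.mor₂ = f)
    (h : HomVanish b T.obj₂ 1) : HomVanish b T.obj₁ 1 := by
  intro f
  obtain ⟨g, hg⟩ := Triangle.coyoneda_exact₃ _ (rot_of_distTriang T hT) f (h _)
  obtain ⟨g', hg'⟩ := happ g
  calc
    f = (g' ≫ T.mor₂) ≫ T.mor₃ := hg.trans (congrArg (fun q : b ⟶ T.obj₃ => q ≫ T.mor₃) hg'.symm)
    _ = 0 := by rw [assoc, comp_distTriang_mor_zero₂₃ T hT, comp_zero]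

end HomVanish

/-- Right approximation of `y` by a finite direct sum of copies of `x`. -/
lemma exists_right_approximation (k : Type*) [CommRing k] [Linear k C] (x y : C)
    [Module.Finite k (x ⟶ y)] :
    ∃ (n : ℕ) (p : (⨁ fun _ : Fin n => x) ⟶ y),
      ∀ f : x ⟶ y, ∃ g : x ⟶ ⨁ fun _ : Fin n => x, g ≫ p = f := by
  obtain ⟨n, v, hv⟩ := Module.Finite.exists_fin (R := k) (M := (x ⟶ y))
  refine ⟨n, biproduct.desc v, fun f => ?_⟩
  obtain ⟨c, hc⟩ := (Submodule.mem_span_range_iff_exists_fun k).1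
    (hv ▸ Submodule.mem_top : f ∈ Submodule.span k (Set.range v))
  refine ⟨biproduct.lift fun j => c j • 𝟙 x, ?_⟩
  rw [biproduct.lift_desc, ← hc]
  simp

namespace IsThickSet

variable {P : Set C}

lemma biprod_mem (hP : IsThickSet P) {x y : C} (hx : x ∈ P) (hy : y ∈ P) : (x ⊞ y) ∈ P :=
  hP.2.2.2.1 _ _ _ _ _ _ (binaryBiproductTriangle_distinguished x y) hx hy

lemma biproduct_mem (hP : IsThickSet P) {x : C} (hx : x ∈ P) (n : ℕ) :
    (⨁ fun _ : Fin n => x) ∈ P := by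
  induction n with
  | zero => exact hP.2.2.2.2 _ x ⟨0, 0, by ext j; exact j.elim0⟩ hx
  | succ n ih =>
    refine hP.2.2.2.2 _ _ ⟨biprod.lift (biproduct.π _ 0)
      (biproduct.lift fun j => biproduct.π (fun _ : Fin (n + 1) => x) j.succ),
      biprod.desc (biproduct.ι (fun _ : Fin (n + 1) => x) 0) (biproduct.desc fun j => biproduct.ι (fun _ : Fin (n + 1) => x) j.succ), ?_⟩
      (hP.biprod_mem hx ih)
    rw [biprod.lift_desc, biproduct.lift_desc, ← biproduct.total, Fin.sum_univ_succ]

lemma obj₃_mem (hP : IsThickSet P) {T : Triangle C} (hT : T ∈ distTriang C)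
    (h₁ : T.obj₁ ∈ P) (h₂ : T.obj₂ ∈ P) : T.obj₃ ∈ P :=
  hP.2.2.2.1 _ _ _ _ _ _ (rot_of_distTriang T hT) h₂ (hP.2.1 _ h₁)

lemma mem_of_shift_mem (hP : IsThickSet P) {x : C} (hx : x⟦(1 : ℤ)⟧ ∈ P) : x ∈ P :=
  hP.1 _ _ ⟨(shiftFunctorCompIsoId C (1 : ℤ) (-1) (by simp)).app x⟩ (hP.2.2.1 _ hx)

end IsThickSet

/-- The objects `y` with `Hom(s, Σⁱy) = 0` for all `i ≥ 1`. -/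
def rightPerp (s : C) : Set C := {y | ∀ i : ℤ, 1 ≤ i → HomVanish s y i}

/-- Every object has no morphisms to large shifts of objects of `rightPerp s`. -/
lemma SiltingObj.exists_bound {s : C} (hs : SiltingObj s) (x : C) :
    ∃ N : ℤ, ∀ n : ℤ, N ≤ n → ∀ y ∈ rightPerp s, HomVanish x y n := by
  refine hs.2 {x | ∃ N : ℤ, ∀ n : ℤ, N ≤ n → ∀ y ∈ rightPerp s, HomVanish x y n}
    ⟨?_, ?_, ?_, ?_, ?_⟩ ⟨1, fun n hn y hy => hy n hn⟩ x
  · rintro x y ⟨e⟩ ⟨N, hN⟩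
    exact ⟨N, fun n hn z hz => (hN n hn z hz).of_retract_left e.inv e.hom (by simp)⟩
  · rintro x ⟨N, hN⟩
    exact ⟨N + 1, fun n hn z hz => (HomVanish.shift_left_iff x z (j := n - 1) (by lia)).2
      (hN _ (by lia) z hz)⟩
  · rintro x ⟨N, hN⟩
    exact ⟨N - 1, fun n hn z hz => (HomVanish.shift_left_iff x z (j := n + 1) (by lia)).2
      (hN _ (by lia) z hz)⟩
  · rintro x y z f g w hT ⟨N, hN⟩ ⟨M, hM⟩
    exact ⟨max N M, fun n hn t ht => HomVanish.contravariant₂ hT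
      (hN n (le_trans (le_max_left _ _) hn) t ht) (hM n (le_trans (le_max_right _ _) hn) t ht)⟩
  · rintro x y ⟨i, r, h⟩ ⟨N, hN⟩
    exact ⟨N, fun n hn z hz => (hN n hn z hz).of_retract_left i r h⟩

section

variable (k : Type*) [CommRing k] [Linear k C]

/-- Objects of `rightPerp s` have a right `add(s)`-approximation with cocone in `rightPerp s`. -/
lemma exists_approximation_triangle {s y : C} (hs : PresiltingObj s) (hy : y ∈ rightPerp s)
    [Module.Finite k (s ⟶ y)] :
    ∃ (n : ℕ) (e : C) (f : e ⟶ ⨁ fun _ : Fin n => s) (g : (⨁ fun _ : Fin n => s) ⟶ y)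
      (h : y ⟶ e⟦(1 : ℤ)⟧), Triangle.mk f g h ∈ distTriang C ∧ e ∈ rightPerp s := by
  obtain ⟨n, g, hg⟩ := exists_right_approximation k s y
  obtain ⟨e, f, h, hT⟩ := distinguished_cocone_triangle₁ g
  refine ⟨n, e, f, g, h, hT, fun i hi => ?_⟩
  have hsn (j : ℤ) (hj : 1 ≤ j) : HomVanish s (⨁ fun _ : Fin n => s) j :=
    HomVanish.biproduct_right (hs j hj) n
  obtain rfl | hi := hi.eq_or_lt
  · exact HomVanish.cocone_of_approximation hT hg (hsn 1 le_rfl)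
  · exact HomVanish.covariant₁ hT (j := -1 + i) rfl (hsn i hi.le) (hy _ (by lia))

lemma SiltingObj.mem_addSet (hfin : ∀ X Y : C, Module.Finite k (X ⟶ Y)) {s x : C}
    (hs : SiltingObj s) (hx : x ∈ rightPerp s)
    (hxs : ∀ i : ℤ, 1 ≤ i → HomVanish x s i) : x ∈ addSet s := by
  have step (N : ℕ) (hN : ∀ y ∈ rightPerp s, HomVanish x y (N + 1)) :
      ∀ y ∈ rightPerp s, HomVanish x y 1 := by
    induction N with
    | zero => simpa using hN
    | succ N ih =>
      refine ih fun y hy => ?_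
      obtain ⟨n, e, f, g, h, hT, he⟩ := exists_approximation_triangle k hs.1 hy
      refine HomVanish.covariant₃ hT (j := ((N + 1 : ℕ) : ℤ) + 1) (by push_cast; ring)
        (HomVanish.biproduct_right (hxs _ (by lia)) n) (hN e he)
  obtain ⟨N, hN⟩ := hs.exists_bound x
  obtain ⟨n, e, f, g, h, hT, he⟩ := exists_approximation_triangle k hs.1 hx
  have hh : h = 0 := step N.toNat (fun y hy => hN _ (by lia) y hy) e he h
  obtain ⟨i, hi⟩ := Triangle.coyoneda_exact₃ _ hT (𝟙 x) (by rw [hh]; exact comp_zero)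
  exact ⟨n, i, g, hi.symm⟩

lemma SiltingObj.mem_twoTermOf (hfin : ∀ X Y : C, Module.Finite k (X ⟶ Y)) {s x : C}
    (hs : SiltingObj s) (hx : x ∈ rightPerp s)
    (hxs : ∀ i : ℤ, 2 ≤ i → HomVanish x s i) : x ∈ twoTermOf s := by
  obtain ⟨n, e, f, g, h, hT, he⟩ := exists_approximation_triangle k hs.1 hx
  refine ⟨e, _, hs.mem_addSet k hfin he fun i hi => ?_, ⟨n, 𝟙 _, 𝟙 _, by simp⟩, f, g, h, hT⟩
  exact HomVanish.contravariant₁ hT (j := i + 1) (by lia)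
    (HomVanish.biproduct_left (hs.1 i hi) n) (hxs _ (by lia))

end

lemma HomVanish.of_mem_addSet_left {s x y : C} {i : ℤ} (hx : x ∈ addSet s)
    (h : HomVanish s y i) : HomVanish x y i := by
  obtain ⟨n, a, r, har⟩ := hx
  exact (h.biproduct_left n).of_retract_left a r har

lemma HomVanish.of_mem_addSet_right {s x y : C} {i : ℤ} (hy : y ∈ addSet s)
    (h : HomVanish x s i) : HomVanish x y i := by
  obtain ⟨n, a, r, har⟩ := hy
  exact (h.biproduct_right n).of_retract_right a r har

lemma PresiltingObj.mem_rightPerp_of_mem_twoTermOf {s t : C} (hs : PresiltingObj s)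
    (ht : t ∈ twoTermOf s) : t ∈ rightPerp s := by
  obtain ⟨s₁, s₀, h₁, h₀, f, g, h, hT⟩ := ht
  exact fun i hi => HomVanish.covariant₃ hT rfl (.of_mem_addSet_right h₀ (hs i hi))
    (.of_mem_addSet_right h₁ (hs _ (by lia)))

lemma PresiltingObj.homVanish_of_mem_twoTermOf {s t : C} (hs : PresiltingObj s)
    (ht : t ∈ twoTermOf s) {i : ℤ} (hi : 2 ≤ i) : HomVanish t s i := by
  obtain ⟨s₁, s₀, h₁, h₀, f, g, h, hT⟩ := ht
  exact HomVanish.contravariant₃ hT (j := i - 1) (by lia)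
    (.of_mem_addSet_left h₀ (hs i (by lia))) (.of_mem_addSet_left h₁ (hs _ (by lia)))

lemma HomVanish.biprod_left {x x' y : C} {i : ℤ} (h : HomVanish x y i) (h' : HomVanish x' y i) :
    HomVanish (x ⊞ x') y i :=
  contravariant₂ (binaryBiproductTriangle_distinguished x x') h h'

lemma HomVanish.biprod_right {x y y' : C} {i : ℤ} (h : HomVanish x y i) (h' : HomVanish x y' i) :
    HomVanish x (y ⊞ y') i :=
  covariant₂ (binaryBiproductTriangle_distinguished y y') h h'

/-- Bongartz completion: in an essentially small, Krull–Schmidt, `k`-linear,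
Hom-finite triangulated category with basic silting object `s`, any presilting object
`u ∈ add(s) * Σ add(s)` admits `u'` in the same subcategory such that `u ⊕ u'` is silting. -/
theorem stmt_8 (k : Type*) [CommRing k] [Linear k C] [EssentiallySmall C]
    (hfin : ∀ X Y : C, Module.Finite k (X ⟶ Y))
    (hKS : KrullSchmidt C)
    (s : C) (hbasic : ∃ (n : ℕ) (f : Fin n → C), BasicDecomp s n f)
    (hs : SiltingObj s)
    (u : C) (hu : u ∈ twoTermOf s) (hpre : PresiltingObj u) :
    ∃ u' : C, u' ∈ twoTermOf s ∧ SiltingObj (u ⊞ u') := by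
  obtain ⟨n, a, ha⟩ := exists_right_approximation k u (s⟦(1 : ℤ)⟧)
  obtain ⟨u', f, h, hT⟩ := distinguished_cocone_triangle₁ a
  have hsu := hs.1.mem_rightPerp_of_mem_twoTermOf hu
  have hsu' : u' ∈ rightPerp s := fun i hi =>
    HomVanish.covariant₁ hT rfl ((hsu i hi).biproduct_right n)
      ((HomVanish.shift_right_iff s s (by lia)).2 (hs.1 i hi))
  have hus' (i : ℤ) (hi : 2 ≤ i) : HomVanish u' s i :=
    HomVanish.contravariant₁ hT (j := i + 1) (by lia)
      ((hs.1.homVanish_of_mem_twoTermOf hu hi).biproduct_left n)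
      ((HomVanish.shift_left_iff s s rfl).2 (hs.1 i (by lia)))
  have huu' (i : ℤ) (hi : 1 ≤ i) : HomVanish u u' i := by
    have huu (j : ℤ) (hj : 1 ≤ j) : HomVanish u (⨁ fun _ : Fin n => u) j :=
      HomVanish.biproduct_right (hpre j hj) n
    obtain rfl | hi := hi.eq_or_lt
    · exact HomVanish.cocone_of_approximation hT ha (huu 1 le_rfl)
    · exact HomVanish.covariant₁ hT rfl (huu i hi.le)
        ((HomVanish.shift_right_iff u s (by lia)).2 (hs.1.homVanish_of_mem_twoTermOf hu hi))
  have of_left (y : C) (i : ℤ) (h₁ : HomVanish u y i) (h₂ : HomVanish s y i) :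
      HomVanish u' y i :=
    HomVanish.contravariant₁ hT (j := i + 1) (by lia) (h₁.biproduct_left n)
      ((HomVanish.shift_left_iff s y rfl).2 h₂)
  refine ⟨u', hs.mem_twoTermOf k hfin hsu' hus', fun i hi => ?_, fun P hP huP => hs.2 P hP ?_⟩
  · exact HomVanish.biprod_left (HomVanish.biprod_right (hpre i hi) (huu' i hi))
      (HomVanish.biprod_right (of_left u i (hpre i hi) (hsu i hi))
        (of_left u' i (huu' i hi) (hsu' i hi)))
  · have hu₁ : u ∈ P := hP.2.2.2.2 _ _ ⟨biprod.inl, biprod.fst, by simp⟩ huP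
    have hu₂ : u' ∈ P := hP.2.2.2.2 _ _ ⟨biprod.inr, biprod.snd, by simp⟩ huP
    exact hP.mem_of_shift_mem (hP.obj₃_mem hT hu₂ (hP.biproduct_mem hu₁ n))
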